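/- arXiv:2510.14399 — 2 statements merged into one kernel-verified Lean document; each statement's English description precedes it below -/
import Mathlib

section
/- Let n < ω and let α be any ordinal. Then ψ_n(α) is strongly critical; that is, ψ_n(α) ≠ 0 and for all ordinals δ, γ < ψ_n(α) one has δ + γ < ψ_n(α) and φ_δ(γ) < ψ_n(α). -/
open Ordinal Set

/-- The Veblen hierarchy: `phi 0` is the strictly increasing enumeration of the
additively principal ordinals (nonzero ordinals closed under addition), and for `α > 0`,
`phi α` is the strictly increasing enumeration of the common fixed points of the
functions `phi δ` for `δ < α`. -/
noncomputable def phi : Ordinal → Ordinal → Ordinal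
  | α => Ordinal.enumOrd {β | (α = 0 → β ≠ 0 ∧ ∀ γ < β, ∀ δ < β, γ + δ < β) ∧
      ∀ δ, δ < α → phi δ β = β}
termination_by α => α
decreasing_by assumption

/-- `Cr 0` is the class of additively principal ordinals (nonzero ordinals `β` such that
`γ + δ < β` for all `γ, δ < β`); for `α > 0`, `Cr α = {β | ∀ δ < α, phi δ β = β}`.
`phi α` is (definitionally) the strictly increasing enumeration of `Cr α`. -/
def Cr (α : Ordinal) : Set Ordinal :=
  {β | (α = 0 → β ≠ 0 ∧ ∀ γ < β, ∀ δ < β, γ + δ < β) ∧ ∀ δ, δ < α → phi δ β = β}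

/-- An ordinal is strongly critical if it is nonzero and closed under `(δ, γ) ↦ phi δ γ`. -/
def StronglyCritical (α : Ordinal) : Prop :=
  α ≠ 0 ∧ ∀ δ < α, ∀ γ < α, phi δ γ < α

/-- `Gamma β` is the `β`-th strongly critical ordinal. -/
noncomputable def Gamma : Ordinal → Ordinal :=
  Ordinal.enumOrd {α | StronglyCritical α}

/-- An ordinal which is (the initial ordinal of) an uncountable regular cardinal. -/
def IsUncountableRegular (o : Ordinal) : Prop :=
  ∃ κ : Cardinal, Cardinal.aleph0 < κ ∧ κ.IsRegular ∧ o = κ.ord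

/-- The base sets `B_n^0(α)` (they do not depend on `α`):
`B_0^0(α) = {0} ∪ {Γ_β : β ≤ θ} ∪ {Ω_m : m ≤ ω}` and
`B_{n+1}^0(α) = {β : β < Ω_n} ∪ {Ω_m : m ≤ ω}`. -/
def Bbase (θ : Ordinal) (Ω : ℕ → Ordinal) (Ωω : Ordinal) : ℕ → Set Ordinal
  | 0 => {0} ∪ {x | ∃ β ≤ θ, x = Gamma β} ∪ {x | (∃ m : ℕ, x = Ω m) ∨ x = Ωω}
  | n + 1 => {β | β < Ω n} ∪ {x | (∃ m : ℕ, x = Ω m) ∨ x = Ωω}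

/-- One closure step, producing `B_n^{k+1}(α)` from `S = B_n^k(α)`, where the function `f`
plays the role of `ψ`:
`S ∪ {δ + δ' : δ, δ' ∈ S} ∪ {phi δ δ' : δ, δ' ∈ S} ∪ {f m δ : m < ω, δ ∈ S, δ < α}`. -/
def Bstep (f : ℕ → Ordinal → Ordinal) (α : Ordinal) (S : Set Ordinal) : Set Ordinal :=
  S ∪ {x | ∃ δ ∈ S, ∃ δ' ∈ S, x = δ + δ'}
    ∪ {x | ∃ δ ∈ S, ∃ δ' ∈ S, x = phi δ δ'}
    ∪ {x | ∃ m : ℕ, ∃ δ ∈ S, δ < α ∧ x = f m δ}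

/-- The sets `B_n^k(α)`, where the function `f` plays the role of `ψ`. -/
def Biter (θ : Ordinal) (Ω : ℕ → Ordinal) (Ωω : Ordinal)
    (f : ℕ → Ordinal → Ordinal) (α : Ordinal) (n : ℕ) : ℕ → Set Ordinal
  | 0 => Bbase θ Ω Ωω n
  | k + 1 => Bstep f α (Biter θ Ω Ωω f α n k)

/-- `psi θ Ω Ωω n α` is the least ordinal not in `B_n(α) = ⋃ k, B_n^k(α)`.  (The values of
`ψ` are only ever used at arguments `δ < α`, so the guard `if δ < α` does not change the
sets `B_n^k(α)`; it only serves to make the recursion on `α` well-founded.) -/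
noncomputable def psi (θ : Ordinal) (Ω : ℕ → Ordinal) (Ωω : Ordinal) : ℕ → Ordinal → Ordinal
  | n, α => sInf {β | β ∉ ⋃ k,
      Biter θ Ω Ωω (fun m δ => if _ : δ < α then psi θ Ω Ωω m δ else 0) α n k}
termination_by n α => α
decreasing_by assumption

/-- The set `B_n(α) = ⋃ k, B_n^k(α)`. -/
noncomputable def Bset (θ : Ordinal) (Ω : ℕ → Ordinal) (Ωω : Ordinal)
    (n : ℕ) (α : Ordinal) : Set Ordinal :=
  ⋃ k, Biter θ Ω Ωω (fun m δ => if _ : δ < α then psi θ Ω Ωω m δ else 0) α n k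

universe v

/-- On a single universe, the Veblen hierarchy `phi` is Mathlib's `Ordinal.veblen`. -/
theorem phi_eq_veblen (o : Ordinal) : phi o = veblen o := by
  induction o using WellFoundedLT.induction with
  | ind o ih =>
    rw [phi, ← enumOrd_range (veblen_right_strictMono o)]
    congr 1
    ext b
    have hfix : (∀ δ < o, phi δ b = b) ↔ ∀ δ < o, veblen δ b = b :=
      forall₂_congr fun δ hδ ↦ by rw [ih δ hδ]
    rw [mem_ofPred_eq, hfix]
    obtain rfl | ho := eq_or_ne o 0
    · have h := isPrincipal_add_iff_zero_or_omega0_opow (o := b)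
      simp only [true_imp_iff, not_lt_zero, false_imp_iff, implies_true, and_true, veblen_zero]
      constructor
      · rintro ⟨hb, hadd⟩
        exact (h.1 fun x y hx hy ↦ hadd x hx y hy).resolve_left hb
      · intro hb
        refine ⟨?_, fun x hx y hy ↦ h.2 (Or.inr hb) hx hy⟩
        obtain ⟨x, rfl⟩ := hb
        exact opow_ne_zero x omega0_ne_zero
    · simp [mem_range_veblen ho, ho]

theorem isPrincipal_veblen_gamma (o : Ordinal) : IsPrincipal veblen (Γ_ o) := by
  intro a b ha hb
  rw [← veblen_gamma_zero o, veblen_lt_veblen_iff]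
  exact Or.inr (Or.inl ⟨ha, by rwa [veblen_gamma_zero]⟩)

/-- An additively principal ordinal that is not a value of `veblen` at smaller arguments
is a `Γ`-number. -/
theorem mem_range_gamma_of_veblen_ne {o : Ordinal} (ho : o ≠ 0)
    (hadd : IsPrincipal (· + ·) o) (H : ∀ a < o, ∀ b < o, veblen a b ≠ o) :
    o ∈ range Γ_ := by
  obtain ⟨x, rfl⟩ := (isPrincipal_add_iff_zero_or_omega0_opow.1 hadd).resolve_left ho
  simp only at ho hadd H ⊢
  have hx : x ≤ ω ^ x := right_le_opow x one_lt_omega0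
  have hinv : ω ^ x ≤ invVeblen₁ x := by
    by_contra! h
    exact H _ h _ (invVeblen₂_lt x) (veblen_invVeblen₁_invVeblen₂ x)
  have hxx : ω ^ x = x := (hinv.trans (invVeblen₁_le x)).antisymm hx
  rw [hxx] at ho hinv ⊢
  exact (invVeblen₁_eq_iff.1 ((invVeblen₁_le x).antisymm hinv)).resolve_left ho

/-- The least ordinal outside a small set containing `0` and closed under addition and `veblen`
is a `Γ`-number. -/
theorem sInf_compl_mem_range_gamma {S : Set Ordinal.{v}} [Small.{v} S] (h0 : 0 ∈ S)
    (hadd : ∀ a ∈ S, ∀ b ∈ S, a + b ∈ S) (hveblen : ∀ a ∈ S, ∀ b ∈ S, veblen a b ∈ S) :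
    sInf Sᶜ ∈ range Γ_ := by
  have hne : Sᶜ.Nonempty := by
    obtain ⟨a, ha⟩ := bddAbove_of_small (s := S)
    exact ⟨a + 1, fun h ↦ (lt_add_one a).not_ge (ha h)⟩
  have hnot : sInf Sᶜ ∉ S := csInf_mem hne
  have hmem : ∀ a < sInf Sᶜ, a ∈ S := fun a ha ↦ not_not.1 (notMem_of_lt_csInf' ha)
  refine mem_range_gamma_of_veblen_ne (fun h ↦ hnot (h ▸ h0))
    (isPrincipal_add_iff_add_lt_ne_self.2 fun a ha b hb h ↦ hnot ?_) fun a ha b hb h ↦ hnot ?_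
  · exact h ▸ hadd a (hmem a ha) b (hmem b hb)
  · exact h ▸ hveblen a (hmem a ha) b (hmem b hb)

section Biter

variable (θ : Ordinal.{v}) (Ω : ℕ → Ordinal.{v}) (Ωω : Ordinal.{v})
  (f : ℕ → Ordinal.{v} → Ordinal.{v}) (α : Ordinal.{v}) (n : ℕ)

theorem small_Bbase : Small.{v} (Bbase θ Ω Ωω n) := by
  have hΩ : Small.{v} {x | (∃ m : ℕ, x = Ω m) ∨ x = Ωω} := by
    have hsub : {x | (∃ m : ℕ, x = Ω m) ∨ x = Ωω} ⊆ range Ω ∪ {Ωω} := by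
      rintro x (⟨m, rfl⟩ | rfl) <;> simp
    exact small_subset hsub
  cases n with
  | zero =>
    have hΓ : Small.{v} {x | ∃ β ≤ θ, x = Gamma β} := by
      have hsub : {x | ∃ β ≤ θ, x = Gamma β} ⊆ Gamma '' Iic θ := by
        rintro x ⟨β, hβ, rfl⟩
        exact mem_image_of_mem _ hβ
      exact small_subset hsub
    unfold Bbase
    infer_instance
  | succ n =>
    have hlt : Small.{v} {β | β < Ω n} := small_Iio (Ω n)
    unfold Bbase
    infer_instance

theorem small_Bstep {S : Set Ordinal.{v}} [Small.{v} S] : Small.{v} (Bstep f α S) := by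
  suffices hsub : Bstep f α S ⊆ S ∪ image2 (· + ·) S S ∪ image2 phi S S ∪ ⋃ m, f m '' S from
    small_subset hsub
  rintro x (((hx | ⟨a, ha, b, hb, rfl⟩) | ⟨a, ha, b, hb, rfl⟩) | ⟨m, a, ha, -, rfl⟩)
  · exact .inl (.inl (.inl hx))
  · exact .inl (.inl (.inr (mem_image2_of_mem ha hb)))
  · exact .inl (.inr (mem_image2_of_mem ha hb))
  · exact .inr (mem_iUnion.2 ⟨m, mem_image_of_mem _ ha⟩)

theorem small_Biter (k : ℕ) : Small.{v} (Biter θ Ω Ωω f α n k) := by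
  induction k with
  | zero => exact small_Bbase θ Ω Ωω n
  | succ k ih => exact small_Bstep f α

theorem monotone_Biter : Monotone (Biter θ Ω Ωω f α n) :=
  monotone_nat_of_le_succ fun _ _ hx ↦ .inl (.inl (.inl hx))

variable {θ Ω Ωω f α n}

theorem add_mem_iUnion_Biter {a b : Ordinal.{v}} (ha : a ∈ ⋃ k, Biter θ Ω Ωω f α n k)
    (hb : b ∈ ⋃ k, Biter θ Ω Ωω f α n k) : a + b ∈ ⋃ k, Biter θ Ω Ωω f α n k := by
  obtain ⟨i, hi⟩ := mem_iUnion.1 ha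
  obtain ⟨j, hj⟩ := mem_iUnion.1 hb
  have hmono := monotone_Biter θ Ω Ωω f α n
  exact mem_iUnion.2 ⟨max i j + 1, .inl (.inl (.inr
    ⟨a, hmono (le_max_left i j) hi, b, hmono (le_max_right i j) hj, rfl⟩))⟩

theorem phi_mem_iUnion_Biter {a b : Ordinal.{v}} (ha : a ∈ ⋃ k, Biter θ Ω Ωω f α n k)
    (hb : b ∈ ⋃ k, Biter θ Ω Ωω f α n k) : phi a b ∈ ⋃ k, Biter θ Ω Ωω f α n k := by
  obtain ⟨i, hi⟩ := mem_iUnion.1 ha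
  obtain ⟨j, hj⟩ := mem_iUnion.1 hb
  have hmono := monotone_Biter θ Ω Ωω f α n
  exact mem_iUnion.2 ⟨max i j + 1, .inl (.inr
    ⟨a, hmono (le_max_left i j) hi, b, hmono (le_max_right i j) hj, rfl⟩)⟩

theorem zero_mem_Bbase (hΩ : ∀ m, Ω m ≠ 0) : 0 ∈ Bbase θ Ω Ωω n := by
  cases n with
  | zero => exact .inl (.inl rfl)
  | succ n => exact .inl (pos_iff_ne_zero.2 (hΩ n))

end Biter

theorem IsUncountableRegular.ne_zero {o : Ordinal} (h : IsUncountableRegular o) : o ≠ 0 := by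
  obtain ⟨κ, hκ, -, rfl⟩ := h
  simpa using (Cardinal.aleph0_pos.trans hκ).ne'

theorem psi_mem_range_gamma (θ : Ordinal) {Ω : ℕ → Ordinal} (Ωω : Ordinal)
    (hΩ : ∀ m, Ω m ≠ 0) (n : ℕ) (α : Ordinal) : psi θ Ω Ωω n α ∈ range Γ_ := by
  rw [psi]
  have := small_Biter θ Ω Ωω (fun m δ ↦ if _ : δ < α then psi θ Ω Ωω m δ else 0) α n
  refine sInf_compl_mem_range_gamma (mem_iUnion.2 ⟨0, zero_mem_Bbase hΩ⟩)
    (fun a ha b hb ↦ add_mem_iUnion_Biter ha hb) fun a ha b hb ↦ ?_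
  rw [← phi_eq_veblen]
  exact phi_mem_iUnion_Biter ha hb

theorem isPrincipal_add_gamma (o : Ordinal) : IsPrincipal (· + ·) (Γ_ o) := by
  rw [isPrincipal_add_iff_zero_or_omega0_opow, ← veblen_gamma_zero]
  exact .inr (veblen_mem_range_opow _ _)

/-- For every `n < ω` and every ordinal `α`, `ψ_n(α)` is strongly critical: it is nonzero
and for all `δ, γ < ψ_n(α)` one has `δ + γ < ψ_n(α)` and `phi δ γ < ψ_n(α)`. -/
theorem psi_stronglyCritical (θ : Ordinal) (Ω : ℕ → Ordinal) (Ωω : Ordinal)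
    (hΩreg : ∀ n : ℕ, IsUncountableRegular (Ω n)) (hΩωreg : IsUncountableRegular Ωω)
    (hΩmono : ∀ n : ℕ, Ω n < Ω (n + 1)) (hΩltω : ∀ n : ℕ, Ω n < Ωω)
    (hθ : θ < Ω 0)
    (n : ℕ) (α : Ordinal) :
    psi θ Ω Ωω n α ≠ 0 ∧
      ∀ δ < psi θ Ω Ωω n α, ∀ γ < psi θ Ω Ωω n α,
        δ + γ < psi θ Ω Ωω n α ∧ phi δ γ < psi θ Ω Ωω n α := by
  obtain ⟨c, hc⟩ := psi_mem_range_gamma θ Ωω (fun m ↦ (hΩreg m).ne_zero) n α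
  rw [← hc]
  refine ⟨gamma_ne_zero, fun δ hδ γ hγ ↦ ⟨isPrincipal_add_gamma c hδ hγ, ?_⟩⟩
  rw [phi_eq_veblen]
  exact isPrincipal_veblen_gamma c hδ hγ
end

section
/- Let n < ω and let α, β be ordinals with β ≤ α. If no element of B_n(α) lies in the half-open interval [β, α), then B_n(β) = B_n(α). -/
open Ordinal Set

theorem Biter_eq_of_forall_lt (θ : Ordinal) (Ω : ℕ → Ordinal) (Ωω : Ordinal)
    {f g : ℕ → Ordinal → Ordinal} {n : ℕ} {α β : Ordinal} (hle : β ≤ α)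
    (hfg : ∀ m, ∀ δ < β, g m δ = f m δ)
    (hdisj : ∀ k, ∀ δ ∈ Biter θ Ω Ωω f α n k, δ < α → δ < β) (k : ℕ) :
    Biter θ Ω Ωω g β n k = Biter θ Ω Ωω f α n k := by
  induction k with
  | zero => rfl
  | succ k ih =>
    simp only [Biter, Bstep, ih]
    congr 1
    ext x
    constructor
    · rintro ⟨m, δ, hδ, hlt, rfl⟩
      exact ⟨m, δ, hδ, hlt.trans_le hle, hfg m δ hlt⟩
    · rintro ⟨m, δ, hδ, hlt, rfl⟩
      have hδβ := hdisj k δ hδ hlt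
      exact ⟨m, δ, hδ, hδβ, (hfg m δ hδβ).symm⟩

/-- If `β ≤ α` and no element of `B_n(α)` lies in the half-open interval `[β, α)`,
then `B_n(β) = B_n(α)`. -/
theorem Bset_eq_of_inter_Ico_eq_empty (θ : Ordinal) (Ω : ℕ → Ordinal) (Ωω : Ordinal)
    (hΩreg : ∀ n : ℕ, IsUncountableRegular (Ω n)) (hΩωreg : IsUncountableRegular Ωω)
    (hΩmono : ∀ n : ℕ, Ω n < Ω (n + 1)) (hΩltω : ∀ n : ℕ, Ω n < Ωω)
    (hθ : θ < Ω 0)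
    (n : ℕ) (α β : Ordinal) (hle : β ≤ α)
    (hdisj : Bset θ Ω Ωω n α ∩ Set.Ico β α = ∅) :
    Bset θ Ω Ωω n β = Bset θ Ω Ωω n α := by
  refine iUnion_congr fun k ↦ Biter_eq_of_forall_lt θ Ω Ωω hle ?_ ?_ k
  · intro m δ hδ
    simp [hδ, hδ.trans_le hle]
  · intro k δ hδ hlt
    by_contra! hge
    exact (hdisj ▸ ⟨mem_iUnion.2 ⟨k, hδ⟩, hge, hlt⟩ : δ ∈ (∅ : Set Ordinal))
end
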